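/- arXiv:2005.02685 — 3 statements merged into one kernel-verified Lean document; each statement's English description precedes it below -/
import Mathlib

section
/- For every integer m ≥ 0, ∑_{k=1}^∞ (ζ(2k) − 1)·F_{2k+m−1} = (π/(2√5))·tan(√5·π/2)·L_m + (1/2)·F_{m+2}. -/
open Real

def lucas : ℕ → ℕ
  | 0 => 2
  | 1 => 1
  | n + 2 => lucas n + lucas (n + 1)

def fibZ (n : ℤ) : ℤ :=
  if 0 ≤ n then (Nat.fib n.toNat : ℤ) else (-1) ^ (n.natAbs + 1) * (Nat.fib n.natAbs : ℤ)

def lucasZ (n : ℤ) : ℤ :=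
  if 0 ≤ n then (lucas n.toNat : ℤ) else (-1) ^ n.natAbs * (lucas n.natAbs : ℤ)

lemma lucas_eq_goldenRatio_pow_add_goldenConj_pow (n : ℕ) :
    (lucas n : ℝ) = goldenRatio ^ n + goldenConj ^ n := by
  induction n using lucas.induct with
  | case1 => norm_num [lucas]
  | case2 => simp [lucas, goldenRatio_add_goldenConj]
  | case3 n ih₁ ih₂ =>
    rw [lucas, Nat.cast_add, ih₁, ih₂, pow_add goldenRatio n 2, pow_add goldenConj n 2,
      goldenRatio_sq, goldenConj_sq]
    ring

lemma Irrational.ofReal_mem_integerComplement {x : ℝ} (hx : Irrational x) :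
    (x : ℂ) ∈ Complex.integerComplement := by
  rintro ⟨n, hn⟩
  exact hx.ne_int n (by exact_mod_cast hn.symm)

lemma hasSum_one_div_nat_add_two_pow {s : ℕ} (hs : 1 < s) :
    HasSum (fun n : ℕ ↦ 1 / (n + 2 : ℂ) ^ s) (riemannZeta s - 1) := by
  have hsum : Summable fun n : ℕ ↦ 1 / (n : ℂ) ^ s := by
    simpa using (Complex.summable_one_div_nat_cpow (p := s)).2 (by simpa using hs)
  have h := (hasSum_nat_add_iff' 2).2 hsum.hasSum
  rw [← zeta_nat_eq_tsum_of_gt_one hs] at h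
  simpa [Finset.sum_range_succ, show s ≠ 0 by lia] using h

lemma norm_natCast_add_two (n : ℕ) : ‖(n + 2 : ℂ)‖ = (n : ℝ) + 2 := by
  rw [← Nat.cast_ofNat, ← Nat.cast_add, Complex.norm_natCast]
  push_cast
  rfl

/-- The double series obtained by expanding `∑ (ζ(2k) - 1) x ^ (2k - 1)` converges absolutely. -/
lemma summable_pow_div_nat_add_two_pow {x : ℂ} (hx : ‖x‖ < 2) :
    Summable fun p : ℕ × ℕ ↦ x ^ (2 * p.1 + 1) / (p.2 + 2 : ℂ) ^ (2 * p.1 + 2) := by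
  have hgeom : Summable fun k : ℕ ↦ ((‖x‖ / 2) ^ 2) ^ k := by
    refine summable_geometric_of_lt_one (by positivity) ?_
    rw [sq_lt_one_iff₀ (by positivity)]
    linarith
  have hsq : Summable fun n : ℕ ↦ ‖x‖ * (1 / ((n : ℝ) + 2) ^ 2) := by
    refine Summable.mul_left _ ?_
    have h := (summable_nat_add_iff 2).2 (Real.summable_one_div_nat_pow.2 one_lt_two)
    simpa using h
  refine Summable.of_norm_bounded (hgeom.mul_of_nonneg hsq (fun _ ↦ by positivity)
    fun _ ↦ by positivity) fun ⟨k, n⟩ ↦ ?_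
  have hn := norm_natCast_add_two n
  have hle : ‖x‖ / ((n : ℝ) + 2) ≤ ‖x‖ / 2 := by
    gcongr
    linarith [(Nat.cast_nonneg n : (0 : ℝ) ≤ n)]
  calc ‖x ^ (2 * k + 1) / (n + 2 : ℂ) ^ (2 * k + 2)‖
      = ((‖x‖ / ((n : ℝ) + 2)) ^ 2) ^ k * (‖x‖ * (1 / ((n : ℝ) + 2) ^ 2)) := by
        rw [norm_div, norm_pow, norm_pow, hn, ← pow_mul, div_pow]
        field_simp
        ring
    _ ≤ ((‖x‖ / 2) ^ 2) ^ k * (‖x‖ * (1 / ((n : ℝ) + 2) ^ 2)) := by gcongr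

lemma hasSum_pow_div_nat_add_two_pow {x : ℂ} (hx : ‖x‖ < 2) (n : ℕ) :
    HasSum (fun k : ℕ ↦ x ^ (2 * k + 1) / (n + 2 : ℂ) ^ (2 * k + 2))
      (x / ((n + 2 : ℂ) ^ 2 - x ^ 2)) := by
  have hn := norm_natCast_add_two n
  have hn0 : (n + 2 : ℂ) ≠ 0 := by
    rw [← norm_pos_iff, hn]
    positivity
  have hlt : ‖(x / (n + 2 : ℂ)) ^ 2‖ < 1 := by
    rw [norm_pow, sq_lt_one_iff₀ (norm_nonneg _), norm_div, hn, div_lt_one (by positivity)]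
    linarith [(Nat.cast_nonneg n : (0 : ℝ) ≤ n)]
  convert! (hasSum_geometric_of_norm_lt_one hlt).mul_left (x / (n + 2 : ℂ) ^ 2) using 1
  · ext k
    rw [← pow_mul, div_pow]
    field_simp
    ring
  · rw [div_pow, one_sub_div (pow_ne_zero 2 hn0), inv_div, div_mul_div_cancel₀ (pow_ne_zero 2 hn0)]

lemma hasSum_div_sq_sub_sq {x : ℂ} (hx : x ∈ Complex.integerComplement) :
    HasSum (fun n : ℕ ↦ x / ((n + 2 : ℂ) ^ 2 - x ^ 2))
      ((1 / x - π * Complex.cot (π * x)) / 2 - x / (1 - x ^ 2)) := by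
  have hcot : HasSum (fun n : ℕ ↦ cotTerm x n) (π * Complex.cot (π * x) - 1 / x) := by
    rw [cot_series_rep' hx]
    exact (summable_cotTerm hx).hasSum
  have hterm (n : ℕ) : -(1 / 2) * cotTerm x n = x / ((n + 1 : ℂ) ^ 2 - x ^ 2) := by
    have h₁ : x + (n + 1 : ℂ) ≠ 0 := by
      simpa using Complex.integerComplement_add_ne_zero hx (n + 1)
    have h₂ : x - (n + 1 : ℂ) ≠ 0 := by
      simpa [sub_eq_add_neg] using Complex.integerComplement_add_ne_zero hx (-(n + 1))
    have h₃ : (n + 1 : ℂ) ^ 2 - x ^ 2 ≠ 0 := by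
      rw [show (n + 1 : ℂ) ^ 2 - x ^ 2 = -((x + (n + 1)) * (x - (n + 1))) by ring]
      exact neg_ne_zero.2 (mul_ne_zero h₁ h₂)
    rw [cotTerm_identity hx, eq_div_iff h₃]
    field_simp
    ring
  have h := hcot.mul_left (-(1 / 2))
  simp_rw [hterm] at h
  convert! (hasSum_nat_add_iff' 1).2 h using 1
  · ext n
    push_cast
    ring_nf
  · simp
    ring

/-- The generating function of `ζ(2k) - 1`, beyond its first singularity. -/
lemma hasSum_riemannZeta_sub_one_mul_pow {x : ℂ} (hx : x ∈ Complex.integerComplement)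
    (hx2 : ‖x‖ < 2) :
    HasSum (fun k : ℕ ↦ (riemannZeta (2 * (k + 1)) - 1) * x ^ (2 * k + 1))
      ((1 / x - π * Complex.cot (π * x)) / 2 - x / (1 - x ^ 2)) := by
  have hsum := (summable_pow_div_nat_add_two_pow hx2).hasSum
  have hrow (k : ℕ) : HasSum (fun n : ℕ ↦ x ^ (2 * k + 1) / (n + 2 : ℂ) ^ (2 * k + 2))
      ((riemannZeta (2 * (k + 1)) - 1) * x ^ (2 * k + 1)) := by
    convert! (hasSum_one_div_nat_add_two_pow (s := 2 * k + 2) (by lia)).mul_right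
      (x ^ (2 * k + 1)) using 1
    · ext n
      ring
    · push_cast
      ring_nf
  have hcol := HasSum.prod_fiberwise ((Equiv.prodComm ℕ ℕ).hasSum_iff.2 hsum)
    (hasSum_pow_div_nat_add_two_pow hx2)
  rw [(hasSum_div_sq_sub_sq hx).unique hcol]
  exact hsum.prod_fiberwise hrow

lemma cot_pi_mul_goldenRatio : Real.cot (π * goldenRatio) = -Real.tan (√5 * π / 2) := by
  rw [show π * goldenRatio = √5 * π / 2 + π / 2 by rw [goldenRatio]; ring, Real.cot_eq_cos_div_sin,
    Real.cos_add_pi_div_two, Real.sin_add_pi_div_two, Real.tan_eq_sin_div_cos, neg_div]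

lemma cot_pi_mul_goldenConj : Real.cot (π * goldenConj) = Real.tan (√5 * π / 2) := by
  rw [show π * goldenConj = π / 2 - √5 * π / 2 by rw [goldenConj]; ring, Real.cot_eq_cos_div_sin,
    Real.cos_pi_div_two_sub, Real.sin_pi_div_two_sub, Real.tan_eq_sin_div_cos]

/-- For a root `x` of `x ^ 2 = x + 1` the rational part of the generating function is constant. -/
lemma hasSum_riemannZeta_sub_one_mul_pow_of_sq_eq {x : ℝ} (hx : Irrational x) (hx2 : |x| < 2)
    (hsq : x ^ 2 = x + 1) (m : ℕ) :
    HasSum (fun k : ℕ ↦ (riemannZeta (2 * (k + 1)) - 1) * ((x ^ (2 * k + m + 1) : ℝ) : ℂ))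
      ((x ^ m * ((x + 1 - π * Real.cot (π * x)) / 2) : ℝ) : ℂ) := by
  have hx0 : x ≠ 0 := hx.ne_zero
  have h := (hasSum_riemannZeta_sub_one_mul_pow hx.ofReal_mem_integerComplement
    (by simpa using hx2)).mul_right ((x : ℂ) ^ m)
  have hval : (1 / x - π * Real.cot (π * x)) / 2 - x / (1 - x ^ 2) =
      (x + 1 - π * Real.cot (π * x)) / 2 := by
    have h₁ : 1 / x = x - 1 := by
      rw [div_eq_iff hx0]
      linear_combination -hsq
    have h₂ : x / (1 - x ^ 2) = -1 := by
      rw [hsq, sub_add_cancel_right, div_neg, div_self hx0]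
    rw [h₁, h₂]
    ring
  rw [← hval]
  convert! h using 1
  · ext k
    push_cast
    ring
  · push_cast
    ring

theorem stmt1 (m : ℕ) :
    ∑' k : ℕ, (riemannZeta (2 * (k + 1)) - 1) * (Nat.fib (2 * k + m + 1) : ℂ) =
      ((π / (2 * Real.sqrt 5) * Real.tan (Real.sqrt 5 * π / 2) * (lucas m : ℝ)
        + (Nat.fib (m + 2) : ℝ) / 2 : ℝ) : ℂ) := by
  have hφ := hasSum_riemannZeta_sub_one_mul_pow_of_sq_eq goldenRatio_irrational
    (abs_lt.2 ⟨by linarith [goldenRatio_pos], goldenRatio_lt_two⟩) goldenRatio_sq m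
  have hψ := hasSum_riemannZeta_sub_one_mul_pow_of_sq_eq goldenConj_irrational
    (abs_lt.2 ⟨by linarith [neg_one_lt_goldenConj], by linarith [goldenConj_neg]⟩) goldenConj_sq m
  convert! ((hφ.sub hψ).mul_right ((1 / √5 : ℝ) : ℂ)).tsum_eq using 1
  · refine tsum_congr fun k ↦ ?_
    rw [← mul_sub, mul_assoc, ← Complex.ofReal_natCast (Nat.fib _), coe_fib_eq]
    push_cast
    ring
  · rw [← Complex.ofReal_sub, ← Complex.ofReal_mul, lucas_eq_goldenRatio_pow_add_goldenConj_pow,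
      coe_fib_eq, cot_pi_mul_goldenRatio, cot_pi_mul_goldenConj, pow_add, pow_add, goldenRatio_sq,
      goldenConj_sq]
    congr 1
    field_simp
    ring
end

section
/- For every integer m ≥ 0, ∑_{k=1}^∞ (ζ(2k+1) − 1)·F_{2k+m} = (F_m + F_{m+2})/2 − F_m·(π/√5)·tan(√5·π/2) − (F_m/2)·∑_{n=1}^∞ 1/(n(n+1)(n² + 3n + 1)). -/
open Real

open Filter Topology

lemma pi_mul_cot_pi_mul_goldenRatio :
    (π : ℂ) * Complex.cot (π * (goldenRatio : ℂ)) =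
      ((-(π * Real.tan (Real.sqrt 5 * π / 2)) : ℝ) : ℂ) := by
  have h : (π : ℂ) * (goldenRatio : ℂ) = ((Real.sqrt 5 * π / 2 + π / 2 : ℝ) : ℂ) := by
    rw [goldenRatio]
    push_cast
    ring
  rw [h, Complex.cot, ← Complex.ofReal_cos, ← Complex.ofReal_sin, Real.cos_add_pi_div_two,
    Real.sin_add_pi_div_two, Real.tan_eq_sin_div_cos]
  push_cast
  ring

lemma natCast_add_goldenRatio_pos (n : ℕ) : 0 < goldenRatio + n := by
  have := goldenRatio_pos
  positivity

lemma goldenRatio_sub_natCast_ne_zero (n : ℕ) : goldenRatio - n ≠ 0 :=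
  sub_ne_zero.mpr (goldenRatio_irrational.ne_nat n)

lemma sq_add_self_sub_one_eq (n : ℕ) :
    (n : ℝ) ^ 2 + n - 1 = -(goldenRatio + n) * (goldenRatio - (n + 1 : ℕ)) := by
  push_cast
  linear_combination goldenRatio_sq

lemma sq_add_self_sub_one_ne_zero (n : ℕ) : (n : ℝ) ^ 2 + n - 1 ≠ 0 := by
  rw [sq_add_self_sub_one_eq]
  exact mul_ne_zero (neg_ne_zero.mpr (natCast_add_goldenRatio_pos n).ne')
    (goldenRatio_sub_natCast_ne_zero _)

lemma sqrt_five_div_sq_add_self_sub_one (n : ℕ) :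
    Real.sqrt 5 / ((n : ℝ) ^ 2 + n - 1) =
      -(1 / (goldenRatio - (n + 1 : ℕ)) + 1 / (goldenRatio + n)) := by
  have h₁ := (natCast_add_goldenRatio_pos n).ne'
  have h₂ := goldenRatio_sub_natCast_ne_zero (n + 1)
  have h₃ : Real.sqrt 5 = 2 * goldenRatio - 1 := by rw [goldenRatio]; ring
  rw [sq_add_self_sub_one_eq, h₃]
  push_cast at h₂ ⊢
  generalize goldenRatio = x at h₁ h₂
  field_simp
  ring

lemma sum_range_one_div_sq_add_self_sub_one (N : ℕ) :
    ∑ n ∈ Finset.range N, 1 / ((n : ℝ) ^ 2 + n - 1) =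
      -(1 / Real.sqrt 5) * (1 / goldenRatio +
        ∑ n ∈ Finset.range N, (1 / (goldenRatio - (n + 1 : ℕ)) + 1 / (goldenRatio + (n + 1 : ℕ)))
        - 1 / (goldenRatio + N)) := by
  have h5 : Real.sqrt 5 ≠ 0 := by positivity
  induction N with
  | zero => simp
  | succ N ih =>
    have h : 1 / ((N : ℝ) ^ 2 + N - 1) =
        1 / Real.sqrt 5 * (Real.sqrt 5 / ((N : ℝ) ^ 2 + N - 1)) := by
      field_simp
    rw [Finset.sum_range_succ, Finset.sum_range_succ, ih, h, sqrt_five_div_sq_add_self_sub_one]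
    ring

lemma tendsto_sum_one_div_sq_add_self_sub_one :
    Tendsto (fun N : ℕ ↦ ∑ n ∈ Finset.range N, 1 / ((n : ℝ) ^ 2 + n - 1)) atTop
      (𝓝 (π / Real.sqrt 5 * Real.tan (Real.sqrt 5 * π / 2))) := by
  have hx : (goldenRatio : ℂ) ∈ Complex.integerComplement := by
    rintro ⟨k, hk⟩
    exact goldenRatio_irrational.ne_int k (by exact_mod_cast hk.symm)
  have hcot : Tendsto (fun N : ℕ ↦ ∑ n ∈ Finset.range N,
      (1 / (goldenRatio - (n + 1 : ℕ)) + 1 / (goldenRatio + (n + 1 : ℕ)))) atTop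
      (𝓝 (-(π * Real.tan (Real.sqrt 5 * π / 2)) - 1 / goldenRatio)) := by
    have h := tendsto_logDeriv_euler_cot_sub hx
    rw [pi_mul_cot_pi_mul_goldenRatio] at h
    rw [← tendsto_ofReal_iff]
    convert h using 2
    · simp [cotTerm]
    · simp
  have hinv : Tendsto (fun N : ℕ ↦ 1 / (goldenRatio + N)) atTop (𝓝 0) :=
    tendsto_const_nhds.div_atTop (tendsto_atTop_add_const_left _ _ tendsto_natCast_atTop_atTop)
  have := ((hcot.const_add (1 / goldenRatio)).sub hinv).const_mul (-(1 / Real.sqrt 5))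
  simp_rw [sum_range_one_div_sq_add_self_sub_one]
  convert this using 2
  ring

lemma hasSum_fib_div_pow (m n : ℕ) :
    HasSum (fun k : ℕ ↦ (Nat.fib (2 * k + m + 2) : ℝ) / ((n : ℝ) + 2) ^ (2 * k + 3))
      ((Nat.fib (m + 2) * ((n : ℝ) + 2) ^ 2 - Nat.fib m) /
        (((n : ℝ) + 2) * (((n : ℝ) + 2) ^ 4 - 3 * ((n : ℝ) + 2) ^ 2 + 1))) := by
  set p : ℝ := (n : ℝ) + 2 with hp
  have hp2 : 2 ≤ p := by simp [hp]
  have hp0 : p ≠ 0 := by positivity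
  have h5 : Real.sqrt 5 ≠ 0 := by positivity
  have hφ : goldenRatio ^ 2 < p ^ 2 := by
    nlinarith [goldenRatio_lt_two, goldenRatio_pos]
  have hψ : goldenConj ^ 2 < p ^ 2 := by
    nlinarith [goldenConj_neg, neg_one_lt_goldenConj]
  have hgeom {x : ℝ} (hx : x ^ 2 < p ^ 2) :
      HasSum (fun k : ℕ ↦ (x ^ 2 / p ^ 2) ^ k) (1 - x ^ 2 / p ^ 2)⁻¹ :=
    hasSum_geometric_of_lt_one (by positivity) ((div_lt_one (by positivity)).mpr hx)
  have h := (((hgeom hφ).mul_left (goldenRatio ^ (m + 2))).sub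
    ((hgeom hψ).mul_left (goldenConj ^ (m + 2)))).mul_left (1 / (Real.sqrt 5 * p ^ 3))
  have hden : p ^ 4 - 3 * p ^ 2 + 1 = (p ^ 2 - goldenRatio ^ 2) * (p ^ 2 - goldenConj ^ 2) := by
    have h₁ := goldenRatio_add_goldenConj
    have h₂ := goldenRatio_mul_goldenConj
    have h₃ : goldenRatio ^ 2 + goldenConj ^ 2 = 3 := by
      linear_combination goldenRatio_sq + goldenConj_sq + h₁
    linear_combination -p ^ 2 * (-h₃) - (goldenRatio * goldenConj - 1) * h₂
  have hφ' : p ^ 2 - goldenRatio ^ 2 ≠ 0 := (sub_pos.mpr hφ).ne'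
  have hψ' : p ^ 2 - goldenConj ^ 2 ≠ 0 := (sub_pos.mpr hψ).ne'
  have h₂ : goldenRatio ^ 2 * goldenConj ^ 2 = 1 := by
    rw [← mul_pow, goldenRatio_mul_goldenConj]; norm_num
  have e {x : ℝ} (hx : p ^ 2 - x ^ 2 ≠ 0) : (1 - x ^ 2 / p ^ 2)⁻¹ = p ^ 2 / (p ^ 2 - x ^ 2) := by
    field_simp
  have hval : (Nat.fib (m + 2) * p ^ 2 - Nat.fib m) / (p * (p ^ 4 - 3 * p ^ 2 + 1)) =
      1 / (Real.sqrt 5 * p ^ 3) * (goldenRatio ^ (m + 2) * (1 - goldenRatio ^ 2 / p ^ 2)⁻¹ -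
        goldenConj ^ (m + 2) * (1 - goldenConj ^ 2 / p ^ 2)⁻¹) := by
    rw [hden, coe_fib_eq, coe_fib_eq, e hφ', e hψ']
    generalize goldenRatio = x at *
    generalize goldenConj = y at *
    field_simp
    linear_combination (x ^ m - y ^ m) * h₂
  rw [hval]
  refine h.congr_fun fun k ↦ ?_
  rw [coe_fib_eq]
  generalize goldenRatio = x
  generalize goldenConj = y
  have hpk : p ^ (2 * k + 3) = p ^ 3 * (p ^ 2) ^ k := by rw [← pow_mul, ← pow_add, add_comm]
  rw [hpk, div_pow, div_pow]
  have hpk0 : (p ^ 2) ^ k ≠ 0 := by positivity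
  generalize (p ^ 2) ^ k = q at hpk0
  field_simp
  ring

lemma fib_gf_decomposition (A B : ℝ) (n : ℕ) :
    (A * ((n : ℝ) + 2) ^ 2 - B) /
        (((n : ℝ) + 2) * (((n : ℝ) + 2) ^ 4 - 3 * ((n : ℝ) + 2) ^ 2 + 1)) =
      A / 2 * (1 / ((n : ℝ) ^ 2 + 3 * n + 1) - 1 / ((n : ℝ) ^ 2 + 5 * n + 5))
      - B / 2 * (1 / ((n : ℝ) + 2) - 1 / ((n : ℝ) + 1))
      - B / 2 * ((n + 1) / ((n : ℝ) ^ 2 + 5 * n + 5) - n / ((n : ℝ) ^ 2 + 3 * n + 1))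
      - B * (1 / ((n : ℝ) ^ 2 + 5 * n + 5))
      - B / 2 * (1 / ((n + 1 : ℝ) * ((n + 1 : ℝ) + 1) *
          ((n + 1 : ℝ) ^ 2 + 3 * (n + 1 : ℝ) + 1))) := by
  have h₁ : (n + 1 : ℝ) ^ 2 + 3 * (n + 1 : ℝ) + 1 = (n : ℝ) ^ 2 + 5 * n + 5 := by ring
  have h₂ : ((n : ℝ) + 2) ^ 4 - 3 * ((n : ℝ) + 2) ^ 2 + 1 =
      ((n : ℝ) ^ 2 + 3 * n + 1) * ((n : ℝ) ^ 2 + 5 * n + 5) := by ring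
  have h₃ : (n + 1 : ℝ) + 1 = n + 2 := by ring
  rw [h₁, h₂, h₃]
  field_simp
  ring

lemma summable_one_div_mul_quadratic :
    Summable fun n : ℕ ↦ 1 / ((n + 1 : ℝ) * ((n + 1 : ℝ) + 1) *
      ((n + 1 : ℝ) ^ 2 + 3 * (n + 1 : ℝ) + 1)) := by
  have h : Summable fun n : ℕ ↦ 1 / ((n + 1 : ℕ) : ℝ) ^ 2 :=
    (summable_nat_add_iff 1).mpr (Real.summable_one_div_nat_pow.mpr one_lt_two)
  refine h.of_nonneg_of_le (fun n ↦ by positivity) fun n ↦ ?_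
  push_cast
  refine one_div_le_one_div_of_le (by positivity) ?_
  have hn : (0 : ℝ) ≤ n := n.cast_nonneg
  have h₁ : (n + 1 : ℝ) ^ 2 ≤ (n + 1 : ℝ) * ((n + 1 : ℝ) + 1) := by nlinarith
  exact h₁.trans (le_mul_of_one_le_right (by positivity) (by nlinarith))

lemma sum_range_one_div_shift (N : ℕ) :
    ∑ n ∈ Finset.range N, 1 / ((n : ℝ) ^ 2 + 5 * n + 5) =
      ∑ n ∈ Finset.range (N + 2), 1 / ((n : ℝ) ^ 2 + n - 1) := by
  rw [Finset.sum_range_succ', Finset.sum_range_succ']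
  norm_num
  refine Finset.sum_congr rfl fun n _ ↦ ?_
  ring

lemma hasSum_fib_gf (m : ℕ) :
    HasSum (fun n : ℕ ↦ (Nat.fib (m + 2) * ((n : ℝ) + 2) ^ 2 - Nat.fib m) /
        (((n : ℝ) + 2) * (((n : ℝ) + 2) ^ 4 - 3 * ((n : ℝ) + 2) ^ 2 + 1)))
      (((Nat.fib m : ℝ) + (Nat.fib (m + 2) : ℝ)) / 2
        - (Nat.fib m : ℝ) * (π / Real.sqrt 5) * Real.tan (Real.sqrt 5 * π / 2)
        - (Nat.fib m : ℝ) / 2 *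
          ∑' n : ℕ, 1 / ((n + 1 : ℝ) * ((n + 1 : ℝ) + 1) *
            ((n + 1 : ℝ) ^ 2 + 3 * (n + 1 : ℝ) + 1))) := by
  rw [hasSum_iff_tendsto_nat_of_nonneg fun n ↦
    (hasSum_fib_div_pow m n).nonneg fun k ↦ by positivity]
  simp_rw [fib_gf_decomposition, Finset.sum_sub_distrib, ← Finset.mul_sum]
  have hT := summable_one_div_mul_quadratic.hasSum.tendsto_sum_nat
  have hB : Tendsto (fun N : ℕ ↦ ∑ n ∈ Finset.range N, 1 / ((n : ℝ) ^ 2 + 5 * n + 5)) atTop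
      (𝓝 (π / Real.sqrt 5 * Real.tan (Real.sqrt 5 * π / 2))) := by
    simp_rw [sum_range_one_div_shift]
    exact tendsto_sum_one_div_sq_add_self_sub_one.comp (tendsto_add_atTop_nat 2)
  have hinv : Tendsto (fun N : ℕ ↦ 1 / ((N : ℝ) + 1)) atTop (𝓝 0) :=
    tendsto_one_div_add_atTop_nhds_zero_nat
  have telescope {f g : ℕ → ℝ} (hfg : ∀ n, g n = f (n + 1)) (hf : Tendsto f atTop (𝓝 0)) :
      Tendsto (fun N ↦ ∑ n ∈ Finset.range N, (g n - f n)) atTop (𝓝 (-f 0)) := by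
    simp_rw [hfg, Finset.sum_range_sub]
    simpa using hf.sub_const (f 0)
  have h₁ := telescope (f := fun n ↦ 1 / ((n : ℝ) ^ 2 + 3 * n + 1))
    (g := fun n ↦ 1 / ((n : ℝ) ^ 2 + 5 * n + 5)) (fun n ↦ by push_cast; ring)
    (squeeze_zero (fun n ↦ by positivity)
      (fun n ↦ one_div_le_one_div_of_le (by positivity) (by nlinarith [n.cast_nonneg (α := ℝ)]))
      hinv)
  have h₂ := telescope (f := fun n ↦ 1 / ((n : ℝ) + 1))
    (g := fun n ↦ 1 / ((n : ℝ) + 2)) (fun n ↦ by push_cast; ring) hinv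
  have h₃ := telescope (f := fun n ↦ (n : ℝ) / ((n : ℝ) ^ 2 + 3 * n + 1))
    (g := fun n ↦ (n + 1) / ((n : ℝ) ^ 2 + 5 * n + 5)) (fun n ↦ by push_cast; ring)
    (squeeze_zero (fun n ↦ by positivity)
      (fun n ↦ (div_le_div_iff₀ (by positivity) (by positivity)).mpr
        (by nlinarith [n.cast_nonneg (α := ℝ)]))
      hinv)
  have := ((((h₁.const_mul (-(Nat.fib (m + 2) / 2 : ℝ))).sub
    (h₂.const_mul (Nat.fib m / 2 : ℝ))).sub (h₃.const_mul (Nat.fib m / 2 : ℝ))).sub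
    (hB.const_mul (Nat.fib m : ℝ))).sub (hT.const_mul (Nat.fib m / 2 : ℝ))
  convert this using 2
  · simp only [Finset.sum_sub_distrib]
    ring
  · norm_num
    ring

lemma hasSum_riemannZeta_sub_one {k : ℕ} (hk : 1 < k) :
    HasSum (fun n : ℕ ↦ 1 / ((n : ℂ) + 2) ^ k) (riemannZeta k - 1) := by
  have h : Summable fun n : ℕ ↦ 1 / (n : ℂ) ^ k := by
    have := Real.summable_one_div_nat_pow.mpr hk
    rw [← Complex.summable_ofReal] at this
    simpa using this
  have h' := h.hasSum
  rw [← zeta_nat_eq_tsum_of_gt_one hk, ← hasSum_nat_add_iff' 2] at h'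
  simpa [Finset.sum_range_succ, (zero_lt_one.trans hk).ne'] using h'

theorem stmt7 (m : ℕ) :
    ∑' k : ℕ, (riemannZeta (2 * (k + 1) + 1) - 1) * (Nat.fib (2 * k + m + 2) : ℂ) =
      ((((Nat.fib m : ℝ) + (Nat.fib (m + 2) : ℝ)) / 2
        - (Nat.fib m : ℝ) * (π / Real.sqrt 5) * Real.tan (Real.sqrt 5 * π / 2)
        - (Nat.fib m : ℝ) / 2 *
          ∑' n : ℕ, 1 / ((n + 1 : ℝ) * ((n + 1 : ℝ) + 1) *
            ((n + 1 : ℝ) ^ 2 + 3 * (n + 1 : ℝ) + 1)) : ℝ) : ℂ) := by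
  have hpos : 0 ≤ fun x : ℕ × ℕ ↦
      (Nat.fib (2 * x.2 + m + 2) : ℝ) / ((x.1 : ℝ) + 2) ^ (2 * x.2 + 3) :=
    fun x ↦ by positivity
  have hrow := hasSum_fib_div_pow m
  have hsum : Summable fun x : ℕ × ℕ ↦
      (Nat.fib (2 * x.2 + m + 2) : ℝ) / ((x.1 : ℝ) + 2) ^ (2 * x.2 + 3) := by
    refine (summable_prod_of_nonneg hpos).mpr ⟨fun n ↦ (hrow n).summable, ?_⟩
    simpa only [(hrow _).tsum_eq] using (hasSum_fib_gf m).summable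
  have hcol (k : ℕ) : (riemannZeta (2 * (k + 1) + 1) - 1) * (Nat.fib (2 * k + m + 2) : ℂ) =
      ((∑' n : ℕ, (Nat.fib (2 * k + m + 2) : ℝ) / ((n : ℝ) + 2) ^ (2 * k + 3) : ℝ) : ℂ) := by
    have h := (hasSum_riemannZeta_sub_one (k := 2 * k + 3) (by omega)).mul_right
      (Nat.fib (2 * k + m + 2) : ℂ)
    have e : (2 * (k + 1) + 1 : ℂ) = ((2 * k + 3 : ℕ) : ℂ) := by push_cast; ring
    rw [e, ← h.tsum_eq, Complex.ofReal_tsum]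
    refine tsum_congr fun n ↦ ?_
    push_cast
    ring
  have hswap := hsum.tsum_comm (f := fun n k : ℕ ↦
    (Nat.fib (2 * k + m + 2) : ℝ) / ((n : ℝ) + 2) ^ (2 * k + 3))
  rw [tsum_congr hcol, ← Complex.ofReal_tsum, hswap, tsum_congr fun n ↦ (hrow n).tsum_eq,
    (hasSum_fib_gf m).tsum_eq]
end

section
/- The series ∑_{k=1}^∞ ζ(2k+1)·F_{2k}/5^k converges and equals 1/2. -/
open Real

theorem hasSum_fib_even_mul_pow {x : ℝ} (hx₀ : 0 ≤ x) (hx : x ≤ 1 / 5) :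
    HasSum (fun k : ℕ => (Nat.fib (2 * (k + 1)) : ℝ) * x ^ (k + 1)) (x / (1 - 3 * x + x ^ 2)) := by
  have hφ : goldenRatio ^ 2 * x < 1 := by
    rw [goldenRatio_sq]; nlinarith [goldenRatio_lt_two]
  have hψ : goldenConj ^ 2 * x < 1 := by
    rw [goldenConj_sq]; nlinarith [goldenConj_neg]
  have geom {r : ℝ} (h₀ : 0 ≤ r) (h₁ : r < 1) :
      HasSum (fun k : ℕ => r ^ (k + 1)) (r * (1 - r)⁻¹) := by
    simpa only [pow_succ'] using (hasSum_geometric_of_lt_one h₀ h₁).mul_left r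
  have h := ((geom (by positivity) hφ).sub (geom (by positivity) hψ)).div_const √5
  have hv : x / (1 - 3 * x + x ^ 2) = (goldenRatio ^ 2 * x * (1 - goldenRatio ^ 2 * x)⁻¹ -
      goldenConj ^ 2 * x * (1 - goldenConj ^ 2 * x)⁻¹) / √5 := by
    have h5 : √5 ≠ 0 := by positivity
    have h₁ : 1 - goldenRatio ^ 2 * x ≠ 0 := by linarith
    have h₂ : 1 - goldenConj ^ 2 * x ≠ 0 := by linarith
    have hprod : 1 - 3 * x + x ^ 2 = (1 - goldenRatio ^ 2 * x) * (1 - goldenConj ^ 2 * x) := by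
      have hm : goldenRatio ^ 2 * goldenConj ^ 2 = 1 := by
        rw [← mul_pow, goldenRatio_mul_goldenConj]; norm_num
      have hs : goldenRatio ^ 2 + goldenConj ^ 2 = 3 := by
        rw [goldenRatio_sq, goldenConj_sq]; linarith [goldenRatio_add_goldenConj]
      linear_combination -x ^ 2 * hm + x * hs
    have hd : goldenRatio ^ 2 - goldenConj ^ 2 = √5 := by
      rw [goldenRatio_sq, goldenConj_sq]; linarith [goldenRatio_sub_goldenConj]
    rw [hprod]
    generalize goldenRatio ^ 2 = a at h₁ hd ⊢
    generalize goldenConj ^ 2 = b at h₂ hd ⊢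
    rw [← div_eq_mul_inv, ← div_eq_mul_inv, div_sub_div _ _ h₁ h₂, div_div,
      div_eq_div_iff (mul_ne_zero h₁ h₂) (mul_ne_zero (mul_ne_zero h₁ h₂) h5)]
    linear_combination -x * (1 - a * x) * (1 - b * x) * hd
  rw [hv]
  refine h.congr_fun fun k => ?_
  rw [coe_fib_eq, mul_pow, mul_pow, ← pow_mul, ← pow_mul]
  ring

theorem hasSum_fib_even_div_pow (n : ℕ) :
    HasSum (fun k : ℕ => (Nat.fib (2 * (k + 1)) : ℝ) / 5 ^ (k + 1) / (n + 1 : ℝ) ^ (2 * (k + 1) + 1))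
      (1 / (2 * (5 * n * (n + 1) + 1)) - 1 / (2 * (5 * (n + 1) * (n + 1 + 1) + 1))) := by
  have hx : 1 / (5 * (n + 1 : ℝ) ^ 2) ≤ 1 / 5 := by
    apply one_div_le_one_div_of_le (by norm_num)
    nlinarith [n.cast_nonneg (α := ℝ)]
  have h := (hasSum_fib_even_mul_pow (by positivity) hx).div_const (n + 1 : ℝ)
  have hden : (1 - 3 * (1 / (5 * (n + 1 : ℝ) ^ 2)) + (1 / (5 * (n + 1 : ℝ) ^ 2)) ^ 2) =
      (5 * n * (n + 1) + 1) * (5 * (n + 1) * (n + 1 + 1) + 1) / (25 * (n + 1) ^ 4) := by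
    field_simp
    ring
  have hv : (1 / (2 * (5 * n * (n + 1) + 1)) - 1 / (2 * (5 * (n + 1) * (n + 1 + 1) + 1)) : ℝ) =
      1 / (5 * (n + 1 : ℝ) ^ 2) /
        (1 - 3 * (1 / (5 * (n + 1 : ℝ) ^ 2)) + (1 / (5 * (n + 1 : ℝ) ^ 2)) ^ 2) / (n + 1) := by
    rw [hden]
    field_simp
    ring
  rw [hv]
  refine h.congr_fun fun k => ?_
  rw [one_div, inv_pow, mul_pow, ← pow_mul, pow_succ _ (2 * (k + 1))]
  field_simp

theorem hasSum_telescoping_half :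
    HasSum (fun n : ℕ => (1 / (2 * (5 * n * (n + 1) + 1)) -
      1 / (2 * (5 * (n + 1) * (n + 1 + 1) + 1)) : ℝ)) (1 / 2) := by
  rw [hasSum_iff_tendsto_nat_of_nonneg]
  · have h (N : ℕ) : ∑ n ∈ Finset.range N, (1 / (2 * (5 * n * (n + 1) + 1)) -
        1 / (2 * (5 * (n + 1) * (n + 1 + 1) + 1)) : ℝ) =
        1 / 2 - 1 / (2 * (5 * N * (N + 1) + 1)) := by
      simpa using Finset.sum_range_sub' (fun n : ℕ => (1 / (2 * (5 * n * (n + 1) + 1)) : ℝ)) N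
    simp_rw [h]
    have hlim : Filter.Tendsto (fun N : ℕ => (1 / (2 * (5 * N * (N + 1) + 1)) : ℝ))
        Filter.atTop (nhds 0) := by
      refine squeeze_zero (fun N => by positivity) (fun N => ?_)
        (tendsto_one_div_add_atTop_nhds_zero_nat (𝕜 := ℝ))
      apply one_div_le_one_div_of_le (by positivity)
      nlinarith [N.cast_nonneg (α := ℝ)]
    simpa only [sub_zero] using hlim.const_sub (1 / 2)
  · intro n
    rw [sub_nonneg]
    apply one_div_le_one_div_of_le (by positivity)
    nlinarith [n.cast_nonneg (α := ℝ)]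

theorem hasSum_zeta_odd_mul_fib_even :
    HasSum (fun k : ℕ => riemannZeta (2 * (k + 1) + 1) * (Nat.fib (2 * (k + 1)) : ℂ) /
      (5 : ℂ) ^ (k + 1)) (1 / 2) := by
  let f : ℕ × ℕ → ℝ := fun p =>
    (Nat.fib (2 * (p.2 + 1)) : ℝ) / 5 ^ (p.2 + 1) / (p.1 + 1 : ℝ) ^ (2 * (p.2 + 1) + 1)
  have hf : Summable f := by
    rw [summable_prod_of_nonneg fun p => by positivity]
    exact ⟨fun n => (hasSum_fib_even_div_pow n).summable,
      hasSum_telescoping_half.summable.congr fun n => (hasSum_fib_even_div_pow n).tsum_eq.symm⟩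
  have hsum : HasSum f (1 / 2) := by
    have h := hf.hasSum.prod_fiberwise hasSum_fib_even_div_pow
    exact h.unique hasSum_telescoping_half ▸ hf.hasSum
  have hswap : HasSum (fun p : ℕ × ℕ => (f p.swap : ℂ)) (1 / 2) := by
    have h := Complex.hasSum_ofReal.mpr ((Equiv.prodComm ℕ ℕ).hasSum_iff.mpr hsum)
    simpa [Function.comp_def] using h
  refine hswap.prod_fiberwise fun k => ?_
  have hz : riemannZeta (2 * (k + 1) + 1) * (Nat.fib (2 * (k + 1)) : ℂ) / (5 : ℂ) ^ (k + 1) =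
      ∑' n : ℕ, (f (n, k) : ℂ) := by
    rw [zeta_eq_tsum_one_div_nat_add_one_cpow (by norm_num; positivity), mul_div_assoc,
      ← tsum_mul_right]
    refine tsum_congr fun n => ?_
    have hc : (2 * (k + 1) + 1 : ℂ) = ((2 * (k + 1) + 1 : ℕ) : ℂ) := by push_cast; ring
    rw [hc, Complex.cpow_natCast]
    simp only [f]
    push_cast
    ring
  rw [hz]
  exact (hswap.summable.prod_factor k).hasSum

theorem stmt10 :
    Summable (fun k : ℕ => riemannZeta (2 * (k + 1) + 1) * (Nat.fib (2 * (k + 1)) : ℂ) / (5 : ℂ) ^ (k + 1)) ∧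
    ∑' k : ℕ, riemannZeta (2 * (k + 1) + 1) * (Nat.fib (2 * (k + 1)) : ℂ) / (5 : ℂ) ^ (k + 1) =
      (1 / 2 : ℂ) :=
  ⟨hasSum_zeta_odd_mul_fib_even.summable, hasSum_zeta_odd_mul_fib_even.tsum_eq⟩
end
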